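/- arXiv:1903.00244 — 2 statements merged into one kernel-verified Lean document; each statement's English description precedes it below -/
import Mathlib

section
/- Assume the coercivity condition (C) and the monotonicity assumption (M), and let λ > 0. If v = (v_i) : 𝕋ⁿ → ℝᵐ has upper semicontinuous components and is a viscosity subsolution of (P_λ), and w = (w_i) : 𝕋ⁿ → ℝᵐ has lower semicontinuous components and is a viscosity supersolution of (P_λ), then v_i(x) ≤ w_i(x) for all x ∈ 𝕋ⁿ and i ∈ 𝕀. -/
open MeasureTheory Filter Topology RealInnerProductSpace

noncomputable section

/-- Euclidean space ℝⁿ, the universal cover of the flat torus 𝕋ⁿ = ℝⁿ/ℤⁿ. -/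
abbrev Euc (n : ℕ) := EuclideanSpace ℝ (Fin n)

/-- A vector of ℝⁿ with integer coordinates (an element of ℤⁿ). -/
def IsIntVec {n : ℕ} (z : Euc n) : Prop := ∀ i, ∃ k : ℤ, z i = (k : ℝ)

/-- ℤⁿ-periodic functions on ℝⁿ: these represent functions on the torus 𝕋ⁿ. -/
def TorusFun {n : ℕ} {α : Type*} (f : Euc n → α) : Prop :=
  ∀ (x z : Euc n), IsIntVec z → f (x + z) = f x

/-- Functions on 𝕋ⁿ × Ξ, i.e. ℤⁿ-periodic in the first variable. -/
def TorusFun2 {n : ℕ} {Ξ : Type*} {α : Type*} (f : Euc n × Ξ → α) : Prop :=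
  ∀ (x z : Euc n) (ξ : Ξ), IsIntVec z → f (x + z, ξ) = f (x, ξ)

/-- The Hamiltonian H_{φ,i}(x,p) = sup_{ξ∈Ξ} (−g_i(x,ξ)·p − φ_i(x,ξ)). -/
def ham {n m : ℕ} {Ξ : Type*} (g : Fin m → Euc n × Ξ → Euc n)
    (φ : Fin m → Euc n × Ξ → ℝ) (i : Fin m) (x p : Euc n) : ℝ :=
  ⨆ ξ : Ξ, (-⟪g i (x, ξ), p⟫ - φ i (x, ξ))

/-- The data g = (g_i), L = (L_i) consist of continuous functions on 𝕋ⁿ × Ξ. -/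
def GoodData {n m : ℕ} {Ξ : Type*} [TopologicalSpace Ξ]
    (g : Fin m → Euc n × Ξ → Euc n) (L : Fin m → Euc n × Ξ → ℝ) : Prop :=
  (∀ i, Continuous (g i) ∧ TorusFun2 (g i)) ∧ (∀ i, Continuous (L i) ∧ TorusFun2 (L i))

/-- Coercivity (C): min_{x∈𝕋ⁿ} H_i(x,p) → ∞ as |p| → ∞. -/
def Coercive {n m : ℕ} {Ξ : Type*} (g : Fin m → Euc n × Ξ → Euc n)
    (L : Fin m → Euc n × Ξ → ℝ) : Prop :=
  ∀ (i : Fin m) (M : ℝ), ∃ R : ℝ, ∀ p : Euc n, R ≤ ‖p‖ → ∀ x : Euc n, M ≤ ham g L i x p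

/-- A monotone m×m real matrix. -/
def IsMonotoneMat {m : ℕ} (B : Matrix (Fin m) (Fin m) ℝ) : Prop :=
  ∀ (u : Fin m → ℝ) (k : Fin m), (∀ i, u i ≤ u k) → 0 ≤ u k → 0 ≤ ∑ j, B k j * u j

/-- Assumption (M): B(x) has continuous entries (as functions on 𝕋ⁿ) and is monotone
for every x. -/
def GoodCoupling {n m : ℕ} (B : Euc n → Matrix (Fin m) (Fin m) ℝ) : Prop :=
  (∀ i j, Continuous (fun x => B x i j) ∧ TorusFun (fun x => B x i j)) ∧
    ∀ x, IsMonotoneMat (B x)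

/-- Viscosity subsolution of λu + Bu + H_φ[u] = c in 𝕋ⁿ. -/
def IsSubsol {n m : ℕ} {Ξ : Type*} (B : Euc n → Matrix (Fin m) (Fin m) ℝ) (lam : ℝ)
    (g : Fin m → Euc n × Ξ → Euc n) (φ : Fin m → Euc n × Ξ → ℝ)
    (c : Fin m → ℝ) (u : Fin m → Euc n → ℝ) : Prop :=
  (∀ i, UpperSemicontinuous (u i) ∧ TorusFun (u i)) ∧
    ∀ (i : Fin m) (ψ : Euc n → ℝ), ContDiff ℝ 1 ψ → TorusFun ψ →
      ∀ x : Euc n, IsLocalMax (fun y => u i y - ψ y) x →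
        lam * u i x + (∑ j, B x i j * u j x) + ham g φ i x (gradient ψ x) ≤ c i

/-- Viscosity supersolution of λu + Bu + H_φ[u] = c in 𝕋ⁿ. -/
def IsSupersol {n m : ℕ} {Ξ : Type*} (B : Euc n → Matrix (Fin m) (Fin m) ℝ) (lam : ℝ)
    (g : Fin m → Euc n × Ξ → Euc n) (φ : Fin m → Euc n × Ξ → ℝ)
    (c : Fin m → ℝ) (u : Fin m → Euc n → ℝ) : Prop :=
  (∀ i, LowerSemicontinuous (u i) ∧ TorusFun (u i)) ∧
    ∀ (i : Fin m) (ψ : Euc n → ℝ), ContDiff ℝ 1 ψ → TorusFun ψ →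
      ∀ x : Euc n, IsLocalMin (fun y => u i y - ψ y) x →
        c i ≤ lam * u i x + (∑ j, B x i j * u j x) + ham g φ i x (gradient ψ x)

/-- Viscosity solution of λu + Bu + H_φ[u] = c in 𝕋ⁿ. -/
def IsSol {n m : ℕ} {Ξ : Type*} (B : Euc n → Matrix (Fin m) (Fin m) ℝ) (lam : ℝ)
    (g : Fin m → Euc n × Ξ → Euc n) (φ : Fin m → Euc n × Ξ → ℝ)
    (c : Fin m → ℝ) (u : Fin m → Euc n → ℝ) : Prop :=
  (∀ i, Continuous (u i)) ∧ IsSubsol B lam g φ c u ∧ IsSupersol B lam g φ c u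

/-- (φ,u) ∈ F(λ): φ ∈ C(𝕋ⁿ×Ξ)ᵐ, u ∈ C(𝕋ⁿ)ᵐ and u is a viscosity subsolution of
B^λ u + H_φ[u] = 0 in 𝕋ⁿ. -/
def memF {n m : ℕ} {Ξ : Type*} [TopologicalSpace Ξ]
    (B : Euc n → Matrix (Fin m) (Fin m) ℝ) (lam : ℝ)
    (g : Fin m → Euc n × Ξ → Euc n)
    (φ : Fin m → Euc n × Ξ → ℝ) (u : Fin m → Euc n → ℝ) : Prop :=
  (∀ i, Continuous (φ i) ∧ TorusFun2 (φ i)) ∧ (∀ i, Continuous (u i)) ∧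
    IsSubsol B lam g φ (fun _ => 0) u

/-- ρ_i(x) = Σ_j b_{ij}(x). -/
def rhoB {n m : ℕ} (B : Euc n → Matrix (Fin m) (Fin m) ℝ) (i : Fin m) (x : Euc n) : ℝ :=
  ∑ j, B x i j

/-- ν ∈ P_{B^λ}: a family of finite nonnegative Borel measures with ⟨ν, B^λ1⟩ = 1. -/
def memPB {n m : ℕ} {Ξ : Type*} [MeasurableSpace Ξ]
    (B : Euc n → Matrix (Fin m) (Fin m) ℝ) (lam : ℝ)
    (ν : Fin m → Measure (Euc n × Ξ)) : Prop :=
  (∀ i, IsFiniteMeasure (ν i)) ∧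
    (∑ i, ∫ q, (lam + rhoB B i q.1) ∂(ν i)) = 1

/-- ν ∈ G'(z,k,λ): ν ∈ P_{B^λ} and ⟨ν, φ − u_k(z) B^λ1⟩ ≥ 0 for every (φ,u) ∈ F(λ). -/
def memGP {n m : ℕ} {Ξ : Type*} [TopologicalSpace Ξ] [MeasurableSpace Ξ]
    (B : Euc n → Matrix (Fin m) (Fin m) ℝ) (lam : ℝ)
    (g : Fin m → Euc n × Ξ → Euc n) (z : Euc n) (k : Fin m)
    (ν : Fin m → Measure (Euc n × Ξ)) : Prop :=
  memPB B lam ν ∧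
    ∀ φ u, memF B lam g φ u →
      0 ≤ ∑ i, ∫ q, (φ i q - u k z * (lam + rhoB B i q.1)) ∂(ν i)

/-- μ ∈ P: a family of nonnegative Borel measures of total mass 1. -/
def memP {n m : ℕ} {Ξ : Type*} [MeasurableSpace Ξ]
    (μ : Fin m → Measure (Euc n × Ξ)) : Prop :=
  (∀ i, IsFiniteMeasure (μ i)) ∧ (∑ i, (μ i Set.univ).toReal) = 1

/-- μ ∈ P(z,k,λ): μ ∈ P and Σ_i ⟨μ_i, (λ+ρ_i)⁻¹ φ_i⟩ ≥ u_k(z) for all (φ,u) ∈ F(λ). -/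
def memPzk {n m : ℕ} {Ξ : Type*} [TopologicalSpace Ξ] [MeasurableSpace Ξ]
    (B : Euc n → Matrix (Fin m) (Fin m) ℝ) (lam : ℝ)
    (g : Fin m → Euc n × Ξ → Euc n) (z : Euc n) (k : Fin m)
    (μ : Fin m → Measure (Euc n × Ξ)) : Prop :=
  memP μ ∧
    ∀ φ u, memF B lam g φ u →
      u k z ≤ ∑ i, ∫ q, (lam + rhoB B i q.1)⁻¹ * φ i q ∂(μ i)

/-- μ ∈ P(0): μ ∈ P and ⟨μ,φ⟩ ≥ 0 for all (φ,u) ∈ F(0). -/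
def memP0 {n m : ℕ} {Ξ : Type*} [TopologicalSpace Ξ] [MeasurableSpace Ξ]
    (B : Euc n → Matrix (Fin m) (Fin m) ℝ)
    (g : Fin m → Euc n × Ξ → Euc n)
    (μ : Fin m → Measure (Euc n × Ξ)) : Prop :=
  memP μ ∧ ∀ φ u, memF B 0 g φ u → 0 ≤ ∑ i, ∫ q, φ i q ∂(μ i)

/-- μ ∈ M₊(0): a family of finite nonnegative Borel measures with ⟨μ,φ⟩ ≥ 0 for all
(φ,u) ∈ F(0). -/
def memM0 {n m : ℕ} {Ξ : Type*} [TopologicalSpace Ξ] [MeasurableSpace Ξ]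
    (B : Euc n → Matrix (Fin m) (Fin m) ℝ)
    (g : Fin m → Euc n × Ξ → Euc n)
    (μ : Fin m → Measure (Euc n × Ξ)) : Prop :=
  (∀ i, IsFiniteMeasure (μ i)) ∧ ∀ φ u, memF B 0 g φ u → 0 ≤ ∑ i, ∫ q, φ i q ∂(μ i)

/-- Assumption (E): problem (P₀) has a Lipschitz continuous viscosity solution. -/
def AssumptionE {n m : ℕ} {Ξ : Type*} (B : Euc n → Matrix (Fin m) (Fin m) ℝ)
    (g : Fin m → Euc n × Ξ → Euc n) (L : Fin m → Euc n × Ξ → ℝ) : Prop :=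
  ∃ v₀ : Fin m → Euc n → ℝ, (∀ i, ∃ K : NNReal, LipschitzWith K (v₀ i)) ∧
    IsSol B 0 g L (fun _ => 0) v₀

end



/-- The closed unit cube. -/
def cubeSet (n : ℕ) : Set (Euc n) := (WithLp.toLp 2) '' (Set.Icc (0 : Fin n → ℝ) 1)

lemma cubeSet_compact (n : ℕ) : IsCompact (cubeSet n) :=
  isCompact_Icc.image (PiLp.continuous_toLp 2 _)

lemma exists_shift {n : ℕ} (x : Euc n) : ∃ z, IsIntVec z ∧ x + z ∈ cubeSet n := by
  refine ⟨WithLp.toLp 2 (fun i => -(⌊x i⌋ : ℝ)), fun i => ⟨-⌊x i⌋, by simp⟩, ?_⟩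
  refine ⟨fun i => Int.fract (x i), ⟨fun i => Int.fract_nonneg _,
    fun i => (Int.fract_lt_one _).le⟩, ?_⟩
  ext i
  simp [Int.fract, sub_eq_add_neg]

lemma cubeSet_nonempty (n : ℕ) : (cubeSet n).Nonempty :=
  let ⟨_, _, h⟩ := exists_shift (0 : Euc n); ⟨_, h⟩

lemma usc_bdd {n : ℕ} {f : Euc n → ℝ} (hf : UpperSemicontinuous f) (hp : TorusFun f) :
    ∃ K, ∀ x, f x ≤ K := by
  obtain ⟨a, _, ha⟩ := UpperSemicontinuousOn.exists_isMaxOn (cubeSet_nonempty n)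
    (cubeSet_compact n) (hf.upperSemicontinuousOn _)
  refine ⟨f a, fun x => ?_⟩
  obtain ⟨z, hz, h⟩ := exists_shift x
  rw [← hp x z hz]
  exact ha h

lemma lsc_bdd {n : ℕ} {f : Euc n → ℝ} (hf : LowerSemicontinuous f) (hp : TorusFun f) :
    ∃ K, ∀ x, K ≤ f x := by
  obtain ⟨a, _, ha⟩ := LowerSemicontinuousOn.exists_isMinOn (cubeSet_nonempty n)
    (cubeSet_compact n) (hf.lowerSemicontinuousOn _)
  refine ⟨f a, fun x => ?_⟩
  obtain ⟨z, hz, h⟩ := exists_shift x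
  rw [← hp x z hz]
  exact ha h

lemma ham_continuous {n m : ℕ} {Ξ : Type*} [MetricSpace Ξ] [CompactSpace Ξ]
    {g : Fin m → Euc n × Ξ → Euc n} {L : Fin m → Euc n × Ξ → ℝ}
    (hgL : GoodData g L) (i : Fin m) :
    Continuous (fun q : Euc n × Euc n => ham g L i q.1 q.2) := by
  have h1 := (hgL.1 i).1
  have h2 := (hgL.2 i).1
  have := IsCompact.continuous_sSup (isCompact_univ (X := Ξ))
    (f := fun (q : Euc n × Euc n) (ξ : Ξ) => -⟪g i (q.1, ξ), q.2⟫ - L i (q.1, ξ))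
    (by
      simp only [Function.HasUncurry.uncurry, id]
      fun_prop)
  simp only [Set.image_univ] at this
  exact this

lemma ham_continuous_left {n m : ℕ} {Ξ : Type*} [MetricSpace Ξ] [CompactSpace Ξ]
    {g : Fin m → Euc n × Ξ → Euc n} {L : Fin m → Euc n × Ξ → ℝ}
    (hgL : GoodData g L) (i : Fin m) (p : Euc n) :
    Continuous (fun x : Euc n => ham g L i x p) := by
  have h1 : Continuous fun x : Euc n => (x, p) := by fun_prop
  exact (ham_continuous hgL i).comp h1

lemma ham_periodic {n m : ℕ} {Ξ : Type*} [MetricSpace Ξ]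
    {g : Fin m → Euc n × Ξ → Euc n} {L : Fin m → Euc n × Ξ → ℝ}
    (hgL : GoodData g L) (i : Fin m) (x z p : Euc n) (hz : IsIntVec z) :
    ham g L i (x + z) p = ham g L i x p := by
  unfold ham
  congr 1
  ext ξ
  rw [(hgL.1 i).2 x z ξ hz, (hgL.2 i).2 x z ξ hz]

/-- Periodic penalty. -/
noncomputable def pen {n : ℕ} (z : Euc n) : ℝ := ∑ j, (1 - Real.cos (2 * Real.pi * z j))

lemma pen_contDiff {n : ℕ} : ContDiff ℝ 1 (pen (n := n)) := by
  unfold pen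
  refine ContDiff.sum fun j _ => contDiff_const.sub ?_
  refine Real.contDiff_cos.comp (contDiff_const.mul ?_)
  fun_prop

lemma pen_nonneg {n : ℕ} (z : Euc n) : 0 ≤ pen z :=
  Finset.sum_nonneg fun _ _ => sub_nonneg.2 (Real.cos_le_one _)

lemma pen_zero {n : ℕ} : pen (0 : Euc n) = 0 := by simp [pen]

lemma pen_periodic {n : ℕ} : TorusFun (pen (n := n)) := by
  intro x z hz
  unfold pen
  refine Finset.sum_congr rfl fun j _ => ?_
  obtain ⟨k, hk⟩ := hz j
  have : 2 * Real.pi * (x + z) j = 2 * Real.pi * x j + k * (2 * Real.pi) := by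
    rw [PiLp.add_apply, hk]; ring
  rw [this, Real.cos_add_int_mul_two_pi]

lemma isIntVec_neg {n : ℕ} {z : Euc n} (hz : IsIntVec z) : IsIntVec (-z) := fun i => by
  obtain ⟨k, hk⟩ := hz i
  exact ⟨-k, by simp [hk]⟩

lemma pen_eq_zero {n : ℕ} {z : Euc n} (h : pen z ≤ 0) : IsIntVec z := by
  have h0 := le_antisymm h (pen_nonneg z)
  unfold pen at h0
  rw [Finset.sum_eq_zero_iff_of_nonneg fun _ _ => sub_nonneg.2 (Real.cos_le_one _)] at h0
  intro j
  have := h0 j (Finset.mem_univ _)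
  obtain ⟨k, hk⟩ := (Real.cos_eq_one_iff _).1 (sub_eq_zero.1 this).symm
  refine ⟨k, ?_⟩
  have hpi := Real.pi_pos
  have : (2 * Real.pi) * (z j - k) = 0 := by linarith
  rcases mul_eq_zero.1 this with h | h
  · linarith
  · linarith

lemma grad_left {n : ℕ} (c : ℝ) (x y : Euc n) :
    gradient (fun a => c * pen (a - y)) x = c • gradient pen (x - y) := by
  have hd : HasFDerivAt (pen (n := n)) (fderiv ℝ pen (x - y)) (x - y) :=
    (pen_contDiff.differentiable one_ne_zero _).hasFDerivAt
  have h : HasFDerivAt (fun a => c * pen (a - y)) (c • fderiv ℝ pen (x - y)) x :=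
    ((hasFDerivAt_comp_sub y).2 hd).const_mul c
  unfold gradient
  rw [h.fderiv]
  simp

lemma grad_right {n : ℕ} (c : ℝ) (x y : Euc n) :
    gradient (fun b => -(c * pen (x - b))) y = c • gradient pen (x - y) := by
  have hd : HasFDerivAt (pen (n := n)) (fderiv ℝ pen (x - y)) (x - y) :=
    (pen_contDiff.differentiable one_ne_zero _).hasFDerivAt
  have h : HasFDerivAt (fun b => -(c * pen (x - b))) (c • fderiv ℝ pen (x - y)) y := by
    have := ((hd.comp y ((hasFDerivAt_id y).const_sub x)).const_mul c).neg
    refine this.congr_fderiv ?_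
    ext u
    simp
  unfold gradient
  rw [h.fderiv]
  simp

/-- Truncation of a supersolution. -/
lemma trunc_super {n m : ℕ} {Ξ : Type*}
    (g : Fin m → Euc n × Ξ → Euc n) (L : Fin m → Euc n × Ξ → ℝ)
    (B : Euc n → Matrix (Fin m) (Fin m) ℝ) (hB : GoodCoupling B)
    (lam : ℝ) (w : Fin m → Euc n → ℝ)
    (hw : IsSupersol B lam g L (fun _ => 0) w) (C : ℝ) (hC : 0 ≤ C)
    (hH : ∀ i x, 0 ≤ lam * C + ham g L i x 0) :
    IsSupersol B lam g L (fun _ => 0) (fun i x => min (w i x) C) := by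
  refine ⟨fun i => ⟨(hw.1 i).1.inf lowerSemicontinuous_const, fun x z hz => ?_⟩, ?_⟩
  · simp only [(hw.1 i).2 x z hz]
  intro i ψ hψ hψp x hx
  rcases le_or_gt (w i x) C with h | h
  · have hmin : IsLocalMin (fun y => w i y - ψ y) x := by
      filter_upwards [hx] with y hy
      simp only [min_eq_left h] at hy
      have := min_le_left (w i y) C
      linarith
    have h1 := hw.2 i ψ hψ hψp x hmin
    have h2 := hB.2 x (fun j => min (w j x) C - w j x) i (fun j => by
      simp only [min_eq_left h, sub_self]
      have := min_le_left (w j x) C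
      linarith) (by simp [min_eq_left h])
    simp only [mul_sub, Finset.sum_sub_distrib] at h2
    simp only [min_eq_left h] at h1 h2 ⊢
    linarith
  · have hmax : IsLocalMax ψ x := by
      filter_upwards [hx] with y hy
      simp only [min_eq_right h.le] at hy
      have := min_le_right (w i y) C
      linarith
    have hg : gradient ψ x = 0 := by
      unfold gradient
      rw [hmax.fderiv_eq_zero]; simp
    have h2 := hB.2 x (fun j => min (w j x) C) i (fun j => by
      simp only [min_eq_right h.le]; exact min_le_right _ _) (by simp [min_eq_right h.le, hC])
    have := hH i x
    simp only [min_eq_right h.le, hg] at h2 ⊢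
    linarith

/-- Existence of a maximum point in the doubling of variables. -/
lemma exists_doubling_max {n m : ℕ} (hm : 0 < m) (v w : Fin m → Euc n → ℝ)
    (hv : ∀ i, UpperSemicontinuous (v i) ∧ TorusFun (v i))
    (hw : ∀ i, LowerSemicontinuous (w i) ∧ TorusFun (w i)) (c : ℝ) :
    ∃ i, ∃ x ∈ cubeSet n, ∃ y ∈ cubeSet n, ∀ j a b,
      v j a - w j b - c * pen (a - b) ≤ v i x - w i y - c * pen (x - y) := by
  have key : ∀ i, ∃ q ∈ cubeSet n ×ˢ cubeSet n, IsMaxOn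
      (fun q : Euc n × Euc n => v i q.1 - w i q.2 - c * pen (q.1 - q.2))
      (cubeSet n ×ˢ cubeSet n) q := by
    intro i
    refine UpperSemicontinuousOn.exists_isMaxOn
      ((cubeSet_nonempty n).prod (cubeSet_nonempty n))
      ((cubeSet_compact n).prod (cubeSet_compact n)) ?_
    refine UpperSemicontinuous.upperSemicontinuousOn ?_ _
    have h1 : UpperSemicontinuous (fun q : Euc n × Euc n => v i q.1) :=
      (hv i).1.comp continuous_fst
    have h2 : LowerSemicontinuous (fun q : Euc n × Euc n => w i q.2) :=
      (hw i).1.comp continuous_snd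
    have h3 : UpperSemicontinuous (fun q : Euc n × Euc n => -w i q.2) :=
      continuous_neg.comp_lowerSemicontinuous_antitone h2 (fun _ _ h => neg_le_neg h)
    have h4 : UpperSemicontinuous (fun q : Euc n × Euc n => -(c * pen (q.1 - q.2))) := by
      refine Continuous.upperSemicontinuous ?_
      have := (pen_contDiff (n := n)).continuous
      fun_prop
    exact (h1.add h3).add h4
  choose q hq hmax using key
  have : Nonempty (Fin m) := ⟨⟨0, hm⟩⟩
  obtain ⟨i, hi⟩ := Finite.exists_max
    (fun i => v i (q i).1 - w i (q i).2 - c * pen ((q i).1 - (q i).2))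
  refine ⟨i, (q i).1, (hq i).1, (q i).2, (hq i).2, fun j a b => ?_⟩
  refine le_trans ?_ (hi j)
  obtain ⟨z, hz, ha⟩ := exists_shift a
  obtain ⟨z', hz', hb⟩ := exists_shift b
  have h := hmax j (Set.mk_mem_prod ha hb)
  simp only [Set.mem_ofPred_eq, (hv j).2 a z hz, (hw j).2 b z' hz'] at h
  have : pen (a + z - (b + z')) = pen (a - b) := by
    have e : a + z - (b + z') = (a - b + z) + (-z') := by abel
    rw [e, pen_periodic _ _ (isIntVec_neg hz'), pen_periodic _ _ hz]
  rwa [this] at h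

/-- Comparison for a bounded supersolution. -/
lemma compare_bdd {n m : ℕ} (hm : 0 < m)
    {Ξ : Type*} [MetricSpace Ξ] [CompactSpace Ξ]
    (g : Fin m → Euc n × Ξ → Euc n) (L : Fin m → Euc n × Ξ → ℝ)
    (hgL : GoodData g L) (hcoer : Coercive g L)
    (B : Euc n → Matrix (Fin m) (Fin m) ℝ) (hB : GoodCoupling B)
    (lam : ℝ) (hlam : 0 < lam)
    (v w : Fin m → Euc n → ℝ)
    (hv : IsSubsol B lam g L (fun _ => 0) v)
    (hw : IsSupersol B lam g L (fun _ => 0) w)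
    (K : ℝ) (hK : ∀ i x, |w i x| ≤ K) :
    ∀ (x : Euc n) (i : Fin m), v i x ≤ w i x := by
  by_contra! hcon
  obtain ⟨x0, i0, h0⟩ := hcon
  set δ := v i0 x0 - w i0 x0 with hδdef
  have hδ : 0 < δ := sub_pos.2 h0
  have hK0 : 0 ≤ K := (abs_nonneg _).trans (hK i0 x0)
  -- upper bounds
  have hvb : ∃ V, ∀ i x, v i x ≤ V := by
    choose V hV using fun i => usc_bdd (hv.1 i).1 (hv.1 i).2
    refine ⟨∑ i, |V i|, fun i x => (hV i x).trans ((le_abs_self _).trans ?_)⟩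
    exact Finset.single_le_sum (f := fun i => |V i|) (fun _ _ => abs_nonneg _) (Finset.mem_univ i)
  obtain ⟨V, hV⟩ := hvb
  have hBb : ∃ b : ℝ, ∀ i x, ∑ j, |B x i j| * K ≤ b := by
    have : ∀ i, ∃ b : ℝ, ∀ x, ∑ j, |B x i j| * K ≤ b := fun i => by
      refine usc_bdd (Continuous.upperSemicontinuous ?_) ?_
      · exact continuous_finsetSum _ fun j _ => ((hB.1 i j).1.abs).mul continuous_const
      · intro x z hz
        refine Finset.sum_congr rfl fun j _ => ?_
        have := (hB.1 i j).2 x z hz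
        simp only at this
        rw [this]
    choose b hb using this
    refine ⟨∑ i, |b i|, fun i x => (hb i x).trans ((le_abs_self _).trans ?_)⟩
    exact Finset.single_le_sum (f := fun i => |b i|) (fun _ _ => abs_nonneg _) (Finset.mem_univ i)
  obtain ⟨b, hb⟩ := hBb
  have hR : ∃ R : ℝ, ∀ i p x, ham g L i x p ≤ lam * K + b → ‖p‖ ≤ R := by
    choose R hR using fun i => hcoer i (lam * K + b + 1)
    refine ⟨∑ i, |R i|, fun i p x h => ?_⟩
    have h1 : ‖p‖ ≤ R i := by
      by_contra! hc
      have := hR i p hc.le x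
      linarith
    refine h1.trans ((le_abs_self _).trans ?_)
    exact Finset.single_le_sum (f := fun i => |R i|) (fun _ _ => abs_nonneg _) (Finset.mem_univ i)
  obtain ⟨R, hR⟩ := hR
  let F : Fin m × Euc n × Euc n × Euc n → ℝ := fun q =>
    ham g L q.1 q.2.2.1 q.2.2.2 - ham g L q.1 q.2.1 q.2.2.2
      + ∑ j, |B q.2.1 q.1 j - B q.2.2.1 q.1 j| * K
  have hF : Continuous F := by
    rw [continuous_prod_of_discrete_left]
    intro i
    have h1 := ham_continuous hgL i
    have h2 : Continuous (fun q : Euc n × Euc n × Euc n => ham g L i q.2.1 q.2.2) :=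
      h1.comp (by fun_prop : Continuous fun q : Euc n × Euc n × Euc n => (q.2.1, q.2.2))
    have h3 : Continuous (fun q : Euc n × Euc n × Euc n => ham g L i q.1 q.2.2) :=
      h1.comp (by fun_prop : Continuous fun q : Euc n × Euc n × Euc n => (q.1, q.2.2))
    refine (h2.sub h3).add (continuous_finsetSum _ fun j _ => ?_)
    have h4 : Continuous (fun q : Euc n × Euc n × Euc n => B q.1 i j) :=
      (hB.1 i j).1.comp continuous_fst
    have h5 : Continuous (fun q : Euc n × Euc n × Euc n => B q.2.1 i j) :=
      (hB.1 i j).1.comp (by fun_prop : Continuous fun q : Euc n × Euc n × Euc n => q.2.1)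
    exact (h4.sub h5).abs.mul continuous_const
  let S : Set (Fin m × Euc n × Euc n × Euc n) :=
    Set.univ ×ˢ (cubeSet n ×ˢ (cubeSet n ×ˢ Metric.closedBall 0 R))
  have hS : IsCompact S := isCompact_univ.prod ((cubeSet_compact n).prod
    ((cubeSet_compact n).prod (isCompact_closedBall _ _)))
  have step : ∀ k : ℕ, ∃ q ∈ S, lam * δ ≤ F q ∧ (k : ℝ) * pen (q.2.1 - q.2.2.1) ≤ V + K := by
    intro k
    obtain ⟨i, x, hx, y, hy, hmax⟩ := exists_doubling_max hm v w hv.1 hw.1 (k : ℝ)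
    have hd := hmax i0 x0 x0
    rw [sub_self, pen_zero, mul_zero, sub_zero] at hd
    have hkp : 0 ≤ (k : ℝ) * pen (x - y) := mul_nonneg (Nat.cast_nonneg _) (pen_nonneg _)
    have hu : δ ≤ v i x - w i y := by linarith
    have hwy := abs_le.1 (hK i y)
    have hmon := hB.2 x (fun j => v j x - w j y) i
      (fun j => by have := hmax j x y; linarith) (by linarith)
    simp only [mul_sub, Finset.sum_sub_distrib] at hmon
    have hsub := hv.2 i (fun a => (k : ℝ) * pen (a - y))
      (contDiff_const.mul (pen_contDiff.comp (contDiff_id.sub contDiff_const)))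
      (fun a z hz => by
        simp only
        rw [show a + z - y = a - y + z by abel, pen_periodic _ _ hz]) x
      (Filter.Eventually.of_forall fun a => by have := hmax i a y; simp only; linarith)
    have hsup := hw.2 i (fun b => -((k : ℝ) * pen (x - b)))
      (contDiff_const.mul (pen_contDiff.comp (contDiff_const.sub contDiff_id))).neg
      (fun a z hz => by
        simp only
        rw [show x - (a + z) = x - a + -z by abel, pen_periodic _ _ (isIntVec_neg hz)]) y
      (Filter.Eventually.of_forall fun a => by have := hmax i x a; simp only; linarith)
    rw [grad_left] at hsub
    rw [grad_right] at hsup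
    set p := (k : ℝ) • gradient pen (x - y) with hp
    have hBw : -b ≤ ∑ j, B x i j * w j y := by
      have : -∑ j, |B x i j| * K ≤ ∑ j, B x i j * w j y := by
        rw [← Finset.sum_neg_distrib]
        refine Finset.sum_le_sum fun j _ => ?_
        have h1 : |B x i j * w j y| ≤ |B x i j| * K := by
          rw [abs_mul]; exact mul_le_mul_of_nonneg_left (hK j y) (abs_nonneg _)
        exact (abs_le.1 h1).1
      have := hb i x
      linarith
    have hlv : lam * (-K) ≤ lam * v i x := mul_le_mul_of_nonneg_left (by linarith) hlam.le
    have hpR : ‖p‖ ≤ R := hR i p x (by linarith)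
    refine ⟨(i, x, y, p), ⟨trivial, hx, hy, by simpa using hpR⟩, ?_, ?_⟩
    · have hdiff : -∑ j, |B x i j - B y i j| * K
          ≤ (∑ j, B x i j * w j y) - ∑ j, B y i j * w j y := by
        rw [← Finset.sum_neg_distrib, ← Finset.sum_sub_distrib]
        refine Finset.sum_le_sum fun j _ => ?_
        rw [← sub_mul]
        have h1 : |(B x i j - B y i j) * w j y| ≤ |B x i j - B y i j| * K := by
          rw [abs_mul]; exact mul_le_mul_of_nonneg_left (hK j y) (abs_nonneg _)
        exact (abs_le.1 h1).1
      have hlu : lam * δ ≤ lam * (v i x - w i y) := mul_le_mul_of_nonneg_left hu hlam.le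
      simp only [F]
      linarith
    · have := hV i x
      simp only
      linarith
  choose q hqS hqF hqp using step
  obtain ⟨a, _, φ, hφ, ht⟩ := hS.tendsto_subseq hqS
  have hFa : lam * δ ≤ F a :=
    ge_of_tendsto' ((hF.tendsto a).comp ht) fun k => hqF (φ k)
  have hpa : pen (a.2.1 - a.2.2.1) ≤ 0 := by
    have hc : Continuous (fun q : Fin m × Euc n × Euc n × Euc n => pen (q.2.1 - q.2.2.1)) :=
      (pen_contDiff (n := n)).continuous.comp (by fun_prop)
    have ht1 := (hc.tendsto a).comp ht
    have ht2 : Tendsto (fun k : ℕ => (V + K) / ((φ k : ℕ) : ℝ)) atTop (𝓝 0) :=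
      (tendsto_const_div_atTop_nhds_zero_nat (V + K)).comp hφ.tendsto_atTop
    refine le_of_tendsto_of_tendsto ht1 ht2 ?_
    filter_upwards [eventually_ge_atTop 1] with k hk
    have : 0 < ((φ k : ℕ) : ℝ) := by
      have := hφ.id_le k
      simp only [id] at this
      exact_mod_cast (by omega : 0 < φ k)
    rw [le_div_iff₀ this, mul_comm]
    exact hqp (φ k)
  have hz := pen_eq_zero hpa
  have e : a.2.1 = a.2.2.1 + (a.2.1 - a.2.2.1) := by abel
  have hFz : F a = 0 := by
    simp only [F]
    have h1 := ham_periodic hgL a.1 a.2.2.1 _ a.2.2.2 hz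
    rw [← e] at h1
    have h2 : ∀ j, B a.2.1 a.1 j = B a.2.2.1 a.1 j := fun j => by
      have := (hB.1 a.1 j).2 a.2.2.1 _ hz
      rw [← e] at this
      exact this
    simp [h1, h2]
  have := mul_pos hlam hδ
  linarith

theorem stmt3 {n m : ℕ} (hn : 0 < n) (hm : 0 < m)
    {Ξ : Type*} [MetricSpace Ξ] [CompactSpace Ξ] [Nonempty Ξ]
    (g : Fin m → Euc n × Ξ → Euc n) (L : Fin m → Euc n × Ξ → ℝ)
    (hgL : GoodData g L) (hcoer : Coercive g L)
    (B : Euc n → Matrix (Fin m) (Fin m) ℝ) (hB : GoodCoupling B)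
    (lam : ℝ) (hlam : 0 < lam)
    (v w : Fin m → Euc n → ℝ)
    (hv : IsSubsol B lam g L (fun _ => 0) v)
    (hw : IsSupersol B lam g L (fun _ => 0) w) :
    ∀ (x : Euc n) (i : Fin m), v i x ≤ w i x := by
  have hH : ∃ C : ℝ, 0 ≤ C ∧ ∀ i x, 0 ≤ lam * C + ham g L i x 0 := by
    have : ∀ i, ∃ b : ℝ, ∀ x, b ≤ ham g L i x 0 := fun i => by
      refine lsc_bdd (f := fun x => ham g L i x 0) (Continuous.lowerSemicontinuous ?_) ?_
      · exact ham_continuous_left hgL i 0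
      · intro x z hz
        exact ham_periodic hgL i x z 0 hz
    choose b hb using this
    have hs : 0 ≤ ∑ i, |b i| := Finset.sum_nonneg fun _ _ => abs_nonneg _
    refine ⟨(∑ i, |b i|) / lam, div_nonneg hs hlam.le, fun i x => ?_⟩
    rw [mul_div_cancel₀ _ hlam.ne']
    have h1 := hb i x
    have h2 := Finset.single_le_sum (f := fun i => |b i|) (fun _ _ => abs_nonneg _)
      (Finset.mem_univ i)
    have h3 := neg_abs_le (b i)
    linarith
  obtain ⟨C, hC, hH⟩ := hH
  have hw' := trunc_super g L B hB lam w hw C hC hH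
  have hbd : ∃ K, ∀ i x, |min (w i x) C| ≤ K := by
    choose b hb using fun i => lsc_bdd (hw.1 i).1 (hw.1 i).2
    have hs : 0 ≤ ∑ i, |b i| := Finset.sum_nonneg fun _ _ => abs_nonneg _
    refine ⟨C + ∑ i, |b i|, fun i x => abs_le.2 ⟨?_, ?_⟩⟩
    · have h1 := hb i x
      have h2 := Finset.single_le_sum (f := fun i => |b i|) (fun _ _ => abs_nonneg _)
        (Finset.mem_univ i)
      have h3 := neg_abs_le (b i)
      exact le_min (by linarith) (by linarith)
    · have := min_le_right (w i x) C
      linarith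
  obtain ⟨K, hK⟩ := hbd
  intro x i
  exact (compare_bdd hm g L hgL hcoer B hB lam hlam v _ hv hw' K hK x i).trans (min_le_left _ _)
end

section
/- Assume the coercivity condition (C) and the monotonicity assumption (M). For every λ ≥ 0 the set F(λ) is a convex cone in C(𝕋ⁿ×Ξ)ᵐ × C(𝕋ⁿ)ᵐ with vertex at the origin: if (φ,u), (ψ,v) ∈ F(λ) and t, s ≥ 0 are real numbers, then t(φ,u) + s(ψ,v) ∈ F(λ). -/
open MeasureTheory Filter Topology RealInnerProductSpace

section helpers

/-- The periodic penalization function. -/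
noncomputable def penS {n : ℕ} (x : Euc n) : ℝ := ∑ k, Real.sin (Real.pi * x k) ^ 2

lemma penS_contDiff {n : ℕ} : ContDiff ℝ 1 (penS (n := n)) := by
  unfold penS
  apply ContDiff.sum
  intro k _
  apply ContDiff.pow
  apply Real.contDiff_sin.comp
  apply contDiff_const.mul
  fun_prop

lemma penS_torus {n : ℕ} : TorusFun (penS (n := n)) := by
  intro x z hz
  unfold penS
  apply Finset.sum_congr rfl
  intro k _
  obtain ⟨j, hj⟩ := hz k
  have : Real.pi * (x + z) k = Real.pi * x k + j * Real.pi := by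
    rw [PiLp.add_apply, hj]; ring
  rw [this, Real.sin_add_int_mul_pi, mul_pow]
  have h1 : (((-1 : ℝ) ^ j) ^ 2) = 1 := by
    rcases Int.even_or_odd j with h | h
    · rw [h.neg_one_zpow]; norm_num
    · rw [h.neg_one_zpow]; norm_num
  rw [h1, one_mul]

lemma penS_nonneg {n : ℕ} (x : Euc n) : 0 ≤ penS x :=
  Finset.sum_nonneg fun _ _ => sq_nonneg _

lemma penS_zero {n : ℕ} : penS (0 : Euc n) = 0 := by
  simp [penS]

lemma penS_neg {n : ℕ} (x : Euc n) : penS (-x) = penS x := by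
  simp [penS]

lemma penS_eq_zero {n : ℕ} (x : Euc n) (hx : ‖x‖ ≤ 1 / 2) (h : penS x ≤ 0) : x = 0 := by
  have h0 : penS x = 0 := le_antisymm h (penS_nonneg x)
  unfold penS at h0
  rw [Finset.sum_eq_zero_iff_of_nonneg (fun _ _ => sq_nonneg _)] at h0
  ext k
  have h1 := h0 k (Finset.mem_univ _)
  have h2 : Real.sin (Real.pi * x k) = 0 := by simpa using h1
  have h3 : |x k| ≤ 1 / 2 := by
    have := PiLp.norm_apply_le x k
    rw [Real.norm_eq_abs] at this
    linarith
  have h4 := abs_le.1 h3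
  have hpi := Real.pi_pos
  rw [Real.sin_eq_zero_iff_of_lt_of_lt (by nlinarith) (by nlinarith)] at h2
  have : x k = 0 := by
    rcases mul_eq_zero.1 h2 with h | h
    · linarith
    · exact h
  simpa using this

lemma continuous_gradient' {n : ℕ} {f : Euc n → ℝ} (hf : ContDiff ℝ 1 f) :
    Continuous (gradient f) := by
  have h : Continuous (fderiv ℝ f) := hf.continuous_fderiv (by norm_num)
  exact (InnerProductSpace.toDual ℝ (Euc n)).symm.continuous.comp h

lemma penS_grad_zero {n : ℕ} : gradient (penS (n := n)) 0 = 0 := by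
  have : IsLocalMin (penS (n := n)) 0 :=
    Filter.Eventually.of_forall fun x => by rw [penS_zero]; exact penS_nonneg x
  unfold gradient
  rw [this.fderiv_eq_zero, map_zero]

lemma grad_test {n : ℕ} {χ : Euc n → ℝ} (hχ : ContDiff ℝ 1 χ) (x x0 y : Euc n) (N : ℝ) :
    gradient (fun x => χ x + penS (x - x0) + N * penS (x - y)) x =
      gradient χ x + gradient penS (x - x0) + N • gradient penS (x - y) := by
  have hS : Differentiable ℝ (penS (n := n)) := penS_contDiff.differentiable (by norm_num)
  have hc : Differentiable ℝ χ := hχ.differentiable (by norm_num)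
  have e1 : ∀ a : Euc n, HasFDerivAt (fun x => penS (x - a)) (fderiv ℝ penS (x - a)) x := by
    intro a
    have := (hS (x - a)).hasFDerivAt.comp x ((hasFDerivAt_id x).sub_const a)
    rw [ContinuousLinearMap.comp_id] at this
    exact this
  have := (((hc x).hasFDerivAt.add (e1 x0)).add ((e1 y).const_mul N)).fderiv
  unfold gradient
  simp only [← map_add, ← map_smul]
  congr 1

lemma grad_test2 {n : ℕ} (x y : Euc n) (N : ℝ) :
    gradient (fun y => N * penS (x - y)) y = - (N • gradient penS (x - y)) := by
  have hS : Differentiable ℝ (penS (n := n)) := penS_contDiff.differentiable (by norm_num)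
  have := ((hS (x - y)).hasFDerivAt.comp y ((hasFDerivAt_id y).const_sub x)).const_mul N
  have h2 := this.fderiv
  unfold gradient
  simp only [← map_neg, ← map_smul]
  congr 1
  refine Eq.trans h2 ?_
  ext z
  simp

variable {n m : ℕ} {Ξ : Type*} [MetricSpace Ξ] [CompactSpace Ξ] [Nonempty Ξ]

lemma ham_term_le {g : Fin m → Euc n × Ξ → Euc n} {φ : Fin m → Euc n × Ξ → ℝ} {i : Fin m}
    (hg : Continuous (g i)) (hφ : Continuous (φ i)) (x p : Euc n) (ξ : Ξ) :
    -⟪g i (x, ξ), p⟫ - φ i (x, ξ) ≤ ham g φ i x p := by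
  unfold ham
  refine le_ciSup (f := fun ξ => -⟪g i (x, ξ), p⟫ - φ i (x, ξ)) ?_ ξ
  have : Continuous (fun ξ => -⟪g i (x, ξ), p⟫ - φ i (x, ξ)) := by fun_prop
  exact (isCompact_range this).bddAbove

lemma grad_bound {g : Fin m → Euc n × Ξ → Euc n} {L φ : Fin m → Euc n × Ξ → ℝ} {i : Fin m}
    (hg : Continuous (g i)) (hL : Continuous (L i)) (hφ : Continuous (φ i))
    (hcoer : Coercive g L) (K : Set (Euc n)) (hK : IsCompact K) (M : ℝ) :
    ∃ R : ℝ, ∀ x ∈ K, ∀ p : Euc n, ham g φ i x p ≤ M → ‖p‖ ≤ R := by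
  have hc : Continuous (fun q => φ i q - L i q) := hφ.sub hL
  obtain ⟨C, hC⟩ := (hK.prod (isCompact_univ (X := Ξ))).bddAbove_image hc.continuousOn
  obtain ⟨R, hR⟩ := hcoer i (M + C + 1)
  refine ⟨R, fun x hx p hp => ?_⟩
  by_contra hcon
  have h1 := hR p (le_of_not_ge hcon) x
  have h2 : ham g L i x p ≤ M + C := by
    refine ciSup_le fun ξ => ?_
    have h3 := ham_term_le hg hφ x p ξ
    have h4 : φ i (x, ξ) - L i (x, ξ) ≤ C :=
      hC (Set.mem_image_of_mem _ (Set.mk_mem_prod hx (Set.mem_univ ξ)))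
    linarith
  linarith

lemma memF_smul {g : Fin m → Euc n × Ξ → Euc n} {φ : Fin m → Euc n × Ξ → ℝ}
    {B : Euc n → Matrix (Fin m) (Fin m) ℝ} {lam : ℝ} {u : Fin m → Euc n → ℝ}
    (hg : ∀ i, Continuous (g i))
    (h : memF B lam g φ u) (t : ℝ) (ht : 0 ≤ t) :
    memF B lam g (fun i q => t * φ i q) (fun i x => t * u i x) := by
  obtain ⟨h1, h2, h3, h4⟩ := h
  refine ⟨fun i => ⟨continuous_const.mul (h1 i).1, fun x z ξ hz => ?_⟩,
    fun i => continuous_const.mul (h2 i),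
    fun i => ⟨(continuous_const.mul (h2 i)).upperSemicontinuous, fun x z hz => ?_⟩, ?_⟩
  · simp only [(h1 i).2 x z ξ hz]
  · simp only [(h3 i).2 x z hz]
  intro i χ hχ hχT x hx
  have hsum : ∑ j, B x i j * (t * u j x) = t * ∑ j, B x i j * u j x := by
    rw [Finset.mul_sum]; exact Finset.sum_congr rfl fun _ _ => by ring
  suffices hh : ham g (fun i q => t * φ i q) i x (gradient χ x) ≤
      -(t * (lam * u i x + ∑ j, B x i j * u j x)) by
    simp only [hsum]; linarith
  refine ciSup_le fun ξ => ?_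
  rcases ht.eq_or_lt with rfl | ht
  · have : IsLocalMax (fun y => - χ y) x := by simpa using hx
    have h5 : gradient χ x = 0 := by
      have h6 : IsLocalMin χ x := by simpa using this.neg
      unfold gradient
      rw [h6.fderiv_eq_zero, map_zero]
    simp [h5]
  · have hx' : IsLocalMax (fun y => u i y - t⁻¹ * χ y) x := by
      filter_upwards [hx] with y hy
      have e : ∀ y, u i y - t⁻¹ * χ y = t⁻¹ * (t * u i y - χ y) := by
        intro y; field_simp
      rw [e, e]
      exact mul_le_mul_of_nonneg_left hy (by positivity)
    have h5 := h4 i (fun y => t⁻¹ * χ y) (contDiff_const.mul hχ)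
      (fun x z hz => by simp only [hχT x z hz]) x hx'
    have h6 : gradient (fun y => t⁻¹ * χ y) x = t⁻¹ • gradient χ x := by
      have := ((hχ.differentiable (by norm_num) x).hasFDerivAt.const_mul t⁻¹).fderiv
      unfold gradient
      rw [← map_smul]
      congr 1
    have h7 := ham_term_le (hg i) (h1 i).1 x (gradient (fun y => t⁻¹ * χ y) x) ξ
    rw [h6, inner_smul_right] at h7
    rw [h6] at h5
    have h8 : t * (-(t⁻¹ * ⟪g i (x, ξ), gradient χ x⟫) - φ i (x, ξ)) ≤
        t * -(lam * u i x + ∑ j, B x i j * u j x) :=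
      mul_le_mul_of_nonneg_left (by linarith) ht.le
    have h9 : t * (-(t⁻¹ * ⟪g i (x, ξ), gradient χ x⟫) - φ i (x, ξ)) =
      -⟪g i (x, ξ), gradient χ x⟫ - t * φ i (x, ξ) := by field_simp
    linarith

lemma ultra_lim {X : Type*} [TopologicalSpace X] {K : Set X} (hK : IsCompact K)
    (f : Ultrafilter ℕ) (a : ℕ → X) (ha : ∀ᶠ N in (f : Filter ℕ), a N ∈ K) :
    ∃ x ∈ K, Tendsto a f (𝓝 x) := by
  obtain ⟨x, hx, h⟩ := hK.ultrafilter_le_nhds (f.map a) (Filter.le_principal_iff.2 ha)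
  exact ⟨x, hx, h⟩

lemma memF_add {g : Fin m → Euc n × Ξ → Euc n} {L φ ψ : Fin m → Euc n × Ξ → ℝ}
    {B : Euc n → Matrix (Fin m) (Fin m) ℝ} {lam : ℝ} {u v : Fin m → Euc n → ℝ}
    (hgL : GoodData g L) (hcoer : Coercive g L) (hB : GoodCoupling B)
    (hu : memF B lam g φ u) (hv : memF B lam g ψ v) :
    memF B lam g (fun i q => φ i q + ψ i q) (fun i x => u i x + v i x) := by
  obtain ⟨hu1, hu2, hu3, hu4⟩ := hu
  obtain ⟨hv1, hv2, hv3, hv4⟩ := hv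
  refine ⟨fun i => ⟨(hu1 i).1.add (hv1 i).1, fun x z ξ hz => ?_⟩,
    fun i => (hu2 i).add (hv2 i),
    fun i => ⟨((hu2 i).add (hv2 i)).upperSemicontinuous, fun x z hz => ?_⟩, ?_⟩
  · simp only [(hu1 i).2 x z ξ hz, (hv1 i).2 x z ξ hz]
  · simp only [(hu3 i).2 x z hz, (hv3 i).2 x z hz]
  intro i χ hχ hχT x0 hx0
  have hgc := (hgL.1 i).1
  have hLc := (hgL.2 i).1
  have hφc := (hu1 i).1
  have hψc := (hv1 i).1
  have huc := hu2 i
  have hvc := hv2 i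
  have hχc := hχ.continuous
  have hSc : Continuous (penS (n := n)) := penS_contDiff.continuous
  have hχg := continuous_gradient' hχ
  have hSg := continuous_gradient' (penS_contDiff (n := n))
  -- the zeroth order terms
  obtain ⟨Zu, hZu⟩ : ∃ Z : Euc n → ℝ, Z = fun x => lam * u i x + ∑ j, B x i j * u j x := ⟨_, rfl⟩
  obtain ⟨Zv, hZv⟩ : ∃ Z : Euc n → ℝ, Z = fun x => lam * v i x + ∑ j, B x i j * v j x := ⟨_, rfl⟩
  have hBc : ∀ j, Continuous (fun x => B x i j) := fun j => (hB.1 i j).1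
  have hZuc : Continuous Zu := by
    rw [hZu]
    exact (continuous_const.mul huc).add
      (continuous_finsetSum _ fun j _ => (hBc j).mul (hu2 j))
  have hZvc : Continuous Zv := by
    rw [hZv]
    exact (continuous_const.mul hvc).add
      (continuous_finsetSum _ fun j _ => (hBc j).mul (hv2 j))
  -- the ball
  obtain ⟨r0, hr0, hball⟩ := Metric.eventually_nhds_iff_ball.1 hx0
  obtain ⟨r, hr⟩ : ∃ r : ℝ, r = min (r0 / 2) (1 / 4) := ⟨_, rfl⟩
  have hrpos : 0 < r := by rw [hr]; positivity
  have hr1 : r < r0 := by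
    have := min_le_left (r0 / 2) (1 / 4 : ℝ)
    rw [← hr] at this; linarith
  have hr2 : r ≤ 1 / 4 := by rw [hr]; exact min_le_right _ _
  obtain ⟨K, hKdef⟩ : ∃ K : Set (Euc n), K = Metric.closedBall x0 r := ⟨_, rfl⟩
  have hK : IsCompact K := by rw [hKdef]; exact isCompact_closedBall _ _
  have hKx0 : x0 ∈ K := by rw [hKdef]; exact Metric.mem_closedBall_self hrpos.le
  have hKnorm : ∀ x ∈ K, ‖x - x0‖ ≤ 1 / 4 := by
    intro x hx
    rw [hKdef, Metric.mem_closedBall, dist_eq_norm] at hx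
    linarith
  have hKmax : ∀ x ∈ K, u i x + v i x - χ x ≤ u i x0 + v i x0 - χ x0 := by
    intro x hx
    apply hball
    rw [hKdef, Metric.mem_closedBall] at hx
    exact Metric.mem_ball.2 (by linarith)
  -- maximizers
  have hex : ∀ N : ℕ, ∃ q ∈ K ×ˢ K, ∀ q' ∈ K ×ˢ K,
      u i q'.1 + v i q'.2 - χ q'.1 - penS (q'.1 - x0) - ((N : ℝ) + 1) * penS (q'.1 - q'.2) ≤
      u i q.1 + v i q.2 - χ q.1 - penS (q.1 - x0) - ((N : ℝ) + 1) * penS (q.1 - q.2) := by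
    intro N
    have hc : Continuous (fun q : Euc n × Euc n =>
      u i q.1 + v i q.2 - χ q.1 - penS (q.1 - x0) - ((N : ℝ) + 1) * penS (q.1 - q.2)) := by
      fun_prop
    obtain ⟨q, hq, h⟩ := (hK.prod hK).exists_isMaxOn ⟨(x0, x0), hKx0, hKx0⟩ hc.continuousOn
    exact ⟨q, hq, fun q' hq' => h hq'⟩
  choose q hqK hqmax using hex
  obtain ⟨f, hf⟩ : ∃ f : Ultrafilter ℕ, (f : Filter ℕ) ≤ atTop :=
    ⟨Filter.hyperfilter ℕ, by rw [← Nat.cofinite_eq_atTop]; exact Filter.hyperfilter_le_cofinite⟩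
  obtain ⟨a, haK, ha⟩ := ultra_lim hK f (fun N => (q N).1) (Eventually.of_forall fun N => (hqK N).1)
  obtain ⟨b, hbK, hb⟩ := ultra_lim hK f (fun N => (q N).2) (Eventually.of_forall fun N => (hqK N).2)
  have hbase : ∀ N : ℕ, ((N : ℝ) + 1) * penS ((q N).1 - (q N).2) ≤
      u i (q N).1 + v i (q N).2 - χ (q N).1 - penS ((q N).1 - x0) -
        (u i x0 + v i x0 - χ x0) := by
    intro N
    have := hqmax N (x0, x0) ⟨hKx0, hKx0⟩
    simp only [sub_self, penS_zero, mul_zero, sub_zero] at this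
    linarith
  have hlimA : Tendsto (fun N => u i (q N).1 + v i (q N).2 - χ (q N).1 - penS ((q N).1 - x0) -
        (u i x0 + v i x0 - χ x0)) f
      (𝓝 (u i a + v i b - χ a - penS (a - x0) - (u i x0 + v i x0 - χ x0))) := by
    have hc : Continuous (fun q : Euc n × Euc n =>
      u i q.1 + v i q.2 - χ q.1 - penS (q.1 - x0) - (u i x0 + v i x0 - χ x0)) := by fun_prop
    exact (hc.tendsto (a, b)).comp (ha.prodMk_nhds hb)
  have hlimS : Tendsto (fun N => penS ((q N).1 - (q N).2)) f (𝓝 (penS (a - b))) :=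
    (hSc.tendsto _).comp (ha.sub hb)
  have hab : a = b := by
    have h0 : penS (a - b) ≤ 0 := by
      have h1 := hlimA.mul ((tendsto_one_div_add_atTop_nhds_zero_nat (𝕜 := ℝ)).mono_left hf)
      rw [mul_zero] at h1
      refine le_of_tendsto_of_tendsto' hlimS h1 fun N => ?_
      have hN : (0 : ℝ) < (N : ℝ) + 1 := by positivity
      rw [mul_one_div, le_div_iff₀ hN, mul_comm]
      exact hbase N
    refine sub_eq_zero.1 (penS_eq_zero _ ?_ h0)
    have : a - b = (a - x0) - (b - x0) := by abel
    rw [this]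
    have h1 := norm_sub_le (a - x0) (b - x0)
    have h2 := hKnorm a haK
    have h3 := hKnorm b hbK
    linarith
  subst hab
  have hax : a = x0 := by
    have h0 : 0 ≤ u i a + v i a - χ a - penS (a - x0) - (u i x0 + v i x0 - χ x0) := by
      refine ge_of_tendsto' hlimA fun N => le_trans ?_ (hbase N)
      have := penS_nonneg ((q N).1 - (q N).2)
      positivity
    have h1 := hKmax a haK
    exact sub_eq_zero.1 (penS_eq_zero _ (by linarith [hKnorm a haK]) (by linarith))
  subst hax
  -- interior
  have hKn : K ∈ 𝓝 a := by rw [hKdef]; exact Metric.closedBall_mem_nhds _ hrpos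
  have hKint : interior K ∈ 𝓝 a := interior_mem_nhds.2 hKn
  obtain ⟨w, hw⟩ : ∃ w : ℕ → Euc n,
    w = fun N : ℕ => ((N : ℝ) + 1) • gradient penS ((q N).1 - (q N).2) := ⟨_, rfl⟩
  have hevu : ∀ᶠ N in (f : Filter ℕ), Zu (q N).1 +
      ham g φ i (q N).1 (gradient χ (q N).1 + gradient penS ((q N).1 - a) + w N) ≤ 0 := by
    filter_upwards [ha.eventually_mem hKint] with N hN
    have h1 := hu4 i (fun x => χ x + penS (x - a) + ((N : ℝ) + 1) * penS (x - (q N).2))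
      ((hχ.add (penS_contDiff.comp (contDiff_id.sub contDiff_const))).add
        (contDiff_const.mul (penS_contDiff.comp (contDiff_id.sub contDiff_const))))
      (fun x z hz => by
        have e : ∀ c, x + z - c = (x - c) + z := fun c => by abel
        simp only [e, hχT x z hz, penS_torus _ z hz]) (q N).1
      (by
        filter_upwards [mem_interior_iff_mem_nhds.1 hN] with x hx
        have := hqmax N (x, (q N).2) ⟨hx, (hqK N).2⟩
        simp only at this
        linarith)
    rw [grad_test hχ] at h1
    rw [hZu, hw]
    exact h1
  have hevv : ∀ᶠ N in (f : Filter ℕ), Zv (q N).2 + ham g ψ i (q N).2 (-(w N)) ≤ 0 := by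
    filter_upwards [hb.eventually_mem hKint] with N hN
    have h1 := hv4 i (fun y => ((N : ℝ) + 1) * penS ((q N).1 - y))
      (contDiff_const.mul (penS_contDiff.comp (contDiff_const.sub contDiff_id)))
      (fun x z hz => by
        have e : (q N).1 - x = ((q N).1 - (x + z)) + z := by abel
        simp only [e, penS_torus _ z hz]) (q N).2
      (by
        filter_upwards [mem_interior_iff_mem_nhds.1 hN] with y hy
        have := hqmax N ((q N).1, y) ⟨(hqK N).1, hy⟩
        simp only at this
        linarith)
    rw [grad_test2] at h1
    rw [hZv, hw]
    exact h1
  -- boundedness of the gradients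
  obtain ⟨M, hM⟩ := hK.bddAbove_image (f := fun x => - Zv x) hZvc.neg.continuousOn
  obtain ⟨R, hR⟩ := grad_bound hgc hLc hψc hcoer K hK M
  have hwb : ∀ᶠ N in (f : Filter ℕ), w N ∈ Metric.closedBall (0 : Euc n) R := by
    filter_upwards [hevv] with N hN
    have h1 : - Zv (q N).2 ≤ M := hM (Set.mem_image_of_mem _ (hqK N).2)
    have h2 := hR _ (hqK N).2 (-(w N)) (by linarith)
    rw [norm_neg] at h2
    simpa using h2
  obtain ⟨p, -, hp⟩ := ultra_lim (isCompact_closedBall (0 : Euc n) R) f w hwb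
  -- conclusion
  have hfin : ham g (fun i q => φ i q + ψ i q) i a (gradient χ a) ≤ -(Zu a + Zv a) := by
    refine ciSup_le fun ξ => ?_
    have hcu : Continuous (fun z : Euc n × Euc n =>
        Zu z.1 + (-⟪g i (z.1, ξ), gradient χ z.1 + gradient penS (z.1 - a) + z.2⟫
          - φ i (z.1, ξ))) := by fun_prop
    have hcv : Continuous (fun z : Euc n × Euc n =>
        Zv z.1 + (-⟪g i (z.1, ξ), -z.2⟫ - ψ i (z.1, ξ))) := by fun_prop
    have h1 := le_of_tendsto ((hcu.tendsto (a, p)).comp (ha.prodMk_nhds hp)) (b := 0) (by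
      filter_upwards [hevu] with N hN
      have := ham_term_le hgc hφc (q N).1
        (gradient χ (q N).1 + gradient penS ((q N).1 - a) + w N) ξ
      simp only [Function.comp]
      linarith)
    have h2 := le_of_tendsto ((hcv.tendsto (a, p)).comp (hb.prodMk_nhds hp)) (b := 0) (by
      filter_upwards [hevv] with N hN
      have := ham_term_le hgc hψc (q N).2 (-(w N)) ξ
      simp only [Function.comp]
      linarith)
    simp only [sub_self, penS_grad_zero, add_zero, inner_add_right, inner_neg_right] at h1 h2
    linarith
  have hsum : ∑ j, B a i j * (u j a + v j a) =
      ∑ j, B a i j * u j a + ∑ j, B a i j * v j a := by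
    rw [← Finset.sum_add_distrib]; exact Finset.sum_congr rfl fun _ _ => by ring
  rw [hZu, hZv] at hfin
  simp only [hsum]
  linarith

end helpers

theorem stmt5 {n m : ℕ} (hn : 0 < n) (hm : 0 < m)
    {Ξ : Type*} [MetricSpace Ξ] [CompactSpace Ξ] [Nonempty Ξ]
    (g : Fin m → Euc n × Ξ → Euc n) (L : Fin m → Euc n × Ξ → ℝ)
    (hgL : GoodData g L) (hcoer : Coercive g L)
    (B : Euc n → Matrix (Fin m) (Fin m) ℝ) (hB : GoodCoupling B)
    (lam : ℝ) (hlam : 0 ≤ lam)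
    (φ ψ : Fin m → Euc n × Ξ → ℝ) (u v : Fin m → Euc n → ℝ)
    (hφu : memF B lam g φ u) (hψv : memF B lam g ψ v)
    (t s : ℝ) (ht : 0 ≤ t) (hs : 0 ≤ s) :
    memF B lam g (fun i q => t * φ i q + s * ψ i q)
      (fun i x => t * u i x + s * v i x) := by
  exact memF_add hgL hcoer hB (memF_smul (fun i => (hgL.1 i).1) hφu t ht)
    (memF_smul (fun i => (hgL.1 i).1) hψv s hs)
end
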